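/- arXiv:1905.05380 — 2 statements merged into one kernel-verified Lean document; each statement's English description precedes it below -/
import Mathlib

section
/- Let A, P, C₁ᵀC₁-factor and input matrices be real matrices of compatible sizes: A, P ∈ ℝ^{n×n} with P symmetric, B₁ ∈ ℝ^{n×m₁}, B₂ ∈ ℝ^{n×m₂}, C₁ ∈ ℝ^{p×n}, and let γ > 0, λ ≥ 0 satisfy the algebraic Riccati equation AᵀP + PA + C₁ᵀC₁ + (1/γ²) P B₁ B₁ᵀ P − P B₂ B₂ᵀ P = 0. For s, d ∈ ℝⁿ and u_e ∈ ℝ^{m₂}, set a := −B₂ᵀ P s + (1/(1+λ)) u_e. If 2 sᵀ P (d + (1/(1+λ)) B₂ u_e) < sᵀ (C₁ᵀC₁ + (1/γ²) P B₁ B₁ᵀ P) s, then 2 sᵀ P (A s + B₂ a + d) < 0. -/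
open Matrix

/-- Lemma 2: With `P` symmetric satisfying the algebraic Riccati equation
`AᵀP + PA + C₁ᵀC₁ + (1/γ²) P B₁ B₁ᵀ P - P B₂ B₂ᵀ P = 0`, and the mixed control
`a = -B₂ᵀ P s + (1/(1+λ)) u_e`, the condition
`2 sᵀ P (d + (1/(1+λ)) B₂ u_e) < sᵀ (C₁ᵀC₁ + (1/γ²) P B₁ B₁ᵀ P) s`
implies `V̇(s) = 2 sᵀ P (A s + B₂ a + d) < 0`. -/
theorem lyapunov_decrease_of_condition {n m₁ m₂ p : ℕ}
    (A P : Matrix (Fin n) (Fin n) ℝ) (B₁ : Matrix (Fin n) (Fin m₁) ℝ)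
    (B₂ : Matrix (Fin n) (Fin m₂) ℝ) (C₁ : Matrix (Fin p) (Fin n) ℝ)
    (γ l : ℝ) (hγ : 0 < γ) (hl : 0 ≤ l) (hP : Pᵀ = P)
    (hric : Aᵀ * P + P * A + C₁ᵀ * C₁ + (1 / γ ^ 2) • (P * B₁ * B₁ᵀ * P)
      - P * B₂ * B₂ᵀ * P = 0)
    (s d : Fin n → ℝ) (u_e : Fin m₂ → ℝ) (a : Fin m₂ → ℝ)
    (ha : a = -(B₂ᵀ *ᵥ (P *ᵥ s)) + (1 / (1 + l)) • u_e)
    (hcond : 2 * (s ⬝ᵥ (P *ᵥ (d + (1 / (1 + l)) • (B₂ *ᵥ u_e))))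
      < s ⬝ᵥ ((C₁ᵀ * C₁ + (1 / γ ^ 2) • (P * B₁ * B₁ᵀ * P)) *ᵥ s)) :
    2 * (s ⬝ᵥ (P *ᵥ (A *ᵥ s + B₂ *ᵥ a + d))) < 0 := by
  have hA : s ⬝ᵥ (Aᵀ * P) *ᵥ s = s ⬝ᵥ P *ᵥ (A *ᵥ s) := by
    rw [← mulVec_mulVec, dotProduct_mulVec, vecMul_transpose, dotProduct_mulVec s,
      ← mulVec_transpose, hP, dotProduct_comm]
  have hB : 0 ≤ s ⬝ᵥ P *ᵥ (B₂ *ᵥ (B₂ᵀ *ᵥ (P *ᵥ s))) := by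
    rw [dotProduct_mulVec, ← mulVec_transpose, hP, dotProduct_mulVec, ← mulVec_transpose]
    exact Finset.sum_nonneg fun i _ => mul_self_nonneg _
  have hq := congrArg (fun M => s ⬝ᵥ M *ᵥ s) hric
  simp only [sub_mulVec, add_mulVec, dotProduct_sub, dotProduct_add, zero_mulVec,
    dotProduct_zero, hA] at hq
  simp only [← mulVec_mulVec] at hq
  simp only [add_mulVec, mulVec_add, dotProduct_add] at hcond
  subst ha
  simp only [mulVec_add, mulVec_neg, mulVec_smul, dotProduct_add, dotProduct_neg] at hcond ⊢
  simp only [smul_mulVec, ← mulVec_mulVec] at hq hcond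
  linarith
end

section
/- Let A, P ∈ ℝ^{n×n} with P symmetric, B₁ ∈ ℝ^{n×m₁}, B₂ ∈ ℝ^{n×m₂}, C₁ ∈ ℝ^{p×n}, γ > 0, λ ≥ 0, and suppose the algebraic Riccati equation AᵀP + PA + C₁ᵀC₁ + (1/γ²) P B₁ B₁ᵀ P − P B₂ B₂ᵀ P = 0 holds. Let σ_m > 0 be such that σ_m ‖s‖₂² ≤ sᵀ (C₁ᵀC₁ + (1/γ²) P B₁ B₁ᵀ P) s for all s ∈ ℝⁿ (e.g. σ_m the minimum eigenvalue of this symmetric matrix). Let C_D, C_π ≥ 0, let d ∈ ℝⁿ with ‖d‖₂ ≤ C_D and u_e ∈ ℝ^{m₂} with ‖u_e‖₂ ≤ C_π, and set a := −B₂ᵀ P s + (1/(1+λ)) u_e. If ‖s‖₂ > (1/σ_m) (2 ‖P‖₂ C_D + (2/(1+λ)) ‖P B₂‖₂ C_π), where ‖·‖₂ on matrices is the ℓ²-operator norm, then 2 sᵀ P (A s + B₂ a + d) < 0. -/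
open Matrix

/-- The Euclidean (ℓ²) norm of a vector in `ℝⁿ`. -/
noncomputable def vecNorm2 {n : ℕ} (v : Fin n → ℝ) : ℝ := Real.sqrt (v ⬝ᵥ v)

/-- The ℓ²-operator norm (largest singular value) of a real matrix, i.e. the operator norm
of the induced linear map between Euclidean spaces. -/
noncomputable def matNorm2 {m n : ℕ} (M : Matrix (Fin m) (Fin n) ℝ) : ℝ :=
  ‖LinearMap.toContinuousLinearMap (Matrix.toEuclideanLin M)‖

theorem vecNorm2_eq_norm_toLp {n : ℕ} (v : Fin n → ℝ) : vecNorm2 v = ‖WithLp.toLp 2 v‖ := by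
  rw [vecNorm2, EuclideanSpace.norm_eq]
  congr 1
  simp [dotProduct, sq]

theorem dotProduct_le_vecNorm2_mul {n : ℕ} (v w : Fin n → ℝ) :
    v ⬝ᵥ w ≤ vecNorm2 v * vecNorm2 w := by
  rw [vecNorm2_eq_norm_toLp, vecNorm2_eq_norm_toLp]
  refine le_trans (le_of_eq ?_) (real_inner_le_norm (WithLp.toLp 2 v) (WithLp.toLp 2 w))
  simp [PiLp.inner_apply, dotProduct, mul_comm]

theorem vecNorm2_mulVec_le {m n : ℕ} (M : Matrix (Fin m) (Fin n) ℝ) (v : Fin n → ℝ) :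
    vecNorm2 (M *ᵥ v) ≤ matNorm2 M * vecNorm2 v := by
  rw [vecNorm2_eq_norm_toLp, vecNorm2_eq_norm_toLp]
  exact (LinearMap.toContinuousLinearMap (Matrix.toEuclideanLin M)).le_opNorm (WithLp.toLp 2 v)

theorem dotProduct_mulVec_le {m n : ℕ} (M : Matrix (Fin m) (Fin n) ℝ) (v : Fin m → ℝ)
    (w : Fin n → ℝ) {c : ℝ} (hw : vecNorm2 w ≤ c) :
    v ⬝ᵥ (M *ᵥ w) ≤ vecNorm2 v * (matNorm2 M * c) :=
  (dotProduct_le_vecNorm2_mul v _).trans <|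
    mul_le_mul_of_nonneg_left
      ((vecNorm2_mulVec_le M w).trans (mul_le_mul_of_nonneg_left hw (norm_nonneg _)))
      (Real.sqrt_nonneg _)

/-- Along a solution of the Riccati equation, the derivative of `sᵀ P s` under the mixed control
splits into a nonpositive part and the contributions of the disturbance and the control
difference. -/
theorem lyapunov_derivative_eq {n m₂ : ℕ} (A P Q : Matrix (Fin n) (Fin n) ℝ)
    (B₂ : Matrix (Fin n) (Fin m₂) ℝ) (hP : Pᵀ = P)
    (hric : Aᵀ * P + P * A + Q - P * B₂ * B₂ᵀ * P = 0)
    (s d : Fin n → ℝ) (u : Fin m₂ → ℝ) (k : ℝ) :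
    2 * (s ⬝ᵥ (P *ᵥ (A *ᵥ s + B₂ *ᵥ (-(B₂ᵀ *ᵥ (P *ᵥ s)) + k • u) + d))) =
      -(s ⬝ᵥ (Q *ᵥ s)) - (B₂ᵀ *ᵥ (P *ᵥ s)) ⬝ᵥ (B₂ᵀ *ᵥ (P *ᵥ s))
        + 2 * (k * (s ⬝ᵥ ((P * B₂) *ᵥ u))) + 2 * (s ⬝ᵥ (P *ᵥ d)) := by
  have hquad := congrArg (fun M : Matrix (Fin n) (Fin n) ℝ => s ⬝ᵥ (M *ᵥ s)) hric
  simp only [add_mulVec, sub_mulVec, dotProduct_add, dotProduct_sub, zero_mulVec,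
    dotProduct_zero, ← mulVec_mulVec] at hquad
  have hA : s ⬝ᵥ (Aᵀ *ᵥ (P *ᵥ s)) = s ⬝ᵥ (P *ᵥ (A *ᵥ s)) := by
    rw [dotProduct_mulVec, vecMul_transpose, dotProduct_mulVec s P, ← mulVec_transpose, hP,
      dotProduct_comm]
  have hB : s ⬝ᵥ (P *ᵥ (B₂ *ᵥ (B₂ᵀ *ᵥ (P *ᵥ s)))) =
      (B₂ᵀ *ᵥ (P *ᵥ s)) ⬝ᵥ (B₂ᵀ *ᵥ (P *ᵥ s)) := by
    rw [dotProduct_mulVec s P, ← mulVec_transpose, hP, dotProduct_mulVec (P *ᵥ s) B₂,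
      ← mulVec_transpose]
  simp only [mulVec_add, mulVec_neg, mulVec_smul, dotProduct_add, dotProduct_neg,
    dotProduct_smul, smul_eq_mul, ← mulVec_mulVec]
  linarith

/-- core of Theorem 2: With `P` symmetric solving the algebraic Riccati
equation, `σ_m > 0` a lower bound for the quadratic form of
`C₁ᵀC₁ + (1/γ²) P B₁ B₁ᵀ P`, bounded disturbance `‖d‖₂ ≤ C_D` and control difference
`‖u_e‖₂ ≤ C_π`, and mixed control `a = -B₂ᵀ P s + (1/(1+λ)) u_e`: if
`‖s‖₂ > (1/σ_m)(2‖P‖₂ C_D + (2/(1+λ))‖P B₂‖₂ C_π)`, then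
`V̇(s) = 2 sᵀ P (A s + B₂ a + d) < 0`. -/
theorem lyapunov_decrease_outside_ball {n m₁ m₂ p : ℕ}
    (A P : Matrix (Fin n) (Fin n) ℝ) (B₁ : Matrix (Fin n) (Fin m₁) ℝ)
    (B₂ : Matrix (Fin n) (Fin m₂) ℝ) (C₁ : Matrix (Fin p) (Fin n) ℝ)
    (γ l σ_m C_D C_π : ℝ) (hγ : 0 < γ) (hl : 0 ≤ l) (hσ : 0 < σ_m)
    (hCD : 0 ≤ C_D) (hCπ : 0 ≤ C_π) (hP : Pᵀ = P)
    (hric : Aᵀ * P + P * A + C₁ᵀ * C₁ + (1 / γ ^ 2) • (P * B₁ * B₁ᵀ * P)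
      - P * B₂ * B₂ᵀ * P = 0)
    (hσm : ∀ s : Fin n → ℝ,
      σ_m * vecNorm2 s ^ 2 ≤ s ⬝ᵥ ((C₁ᵀ * C₁ + (1 / γ ^ 2) • (P * B₁ * B₁ᵀ * P)) *ᵥ s))
    (s d : Fin n → ℝ) (u_e : Fin m₂ → ℝ) (a : Fin m₂ → ℝ)
    (hd : vecNorm2 d ≤ C_D) (hu : vecNorm2 u_e ≤ C_π)
    (ha : a = -(B₂ᵀ *ᵥ (P *ᵥ s)) + (1 / (1 + l)) • u_e)
    (hs : vecNorm2 s >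
      (1 / σ_m) * (2 * matNorm2 P * C_D + (2 / (1 + l)) * matNorm2 (P * B₂) * C_π)) :
    2 * (s ⬝ᵥ (P *ᵥ (A *ᵥ s + B₂ *ᵥ a + d))) < 0 := by
  have hk : 0 ≤ 1 / (1 + l) := by positivity
  have hPd := dotProduct_mulVec_le P s d hd
  have hPBu := mul_le_mul_of_nonneg_left (dotProduct_mulVec_le (P * B₂) s u_e hu) hk
  have hBPs : 0 ≤ (B₂ᵀ *ᵥ (P *ᵥ s)) ⬝ᵥ (B₂ᵀ *ᵥ (P *ᵥ s)) :=
    Finset.sum_nonneg fun i _ => mul_self_nonneg _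
  have hM : 0 ≤ matNorm2 P := norm_nonneg _
  have hN : 0 ≤ matNorm2 (P * B₂) := norm_nonneg _
  have hpos : 0 < vecNorm2 s := lt_of_le_of_lt (by positivity) hs
  have hs' : 2 * matNorm2 P * C_D + (2 / (1 + l)) * matNorm2 (P * B₂) * C_π
      < σ_m * vecNorm2 s := by
    rwa [gt_iff_lt, one_div_mul_eq_div, div_lt_iff₀' hσ] at hs
  have hprod := mul_lt_mul_of_pos_left hs' hpos
  rw [ha, lyapunov_derivative_eq A P (C₁ᵀ * C₁ + (1 / γ ^ 2) • (P * B₁ * B₁ᵀ * P)) B₂ hP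
    (by simpa only [add_assoc] using hric)]
  rw [show 2 / (1 + l) = 2 * (1 / (1 + l)) by ring] at hprod
  linarith [hσm s]
end
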